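/- If a first-order L-theory T is κ-rich and λ ≥ κ, then T is λ-rich. -/

import Mathlib

open FirstOrder Language

namespace Potentialist

/-- The underlying data of a potentialist system: a collection of worlds, each carrying a
first-order `L`-structure. -/
structure PreSys.{u, v, w, x} (L : FirstOrder.Language.{u, v}) where
  World : Type w
  Dom : World → Type x
  str : ∀ W, L.Structure (Dom W)

attribute [instance] PreSys.str

/-- A potentialist system: a collection of first-order `L`-structures together with a
collection of `L`-embeddings between them, containing all identity embeddings and closed
under composition. -/
structure PotSys.{u, v, w, x} (L : FirstOrder.Language.{u, v})
    extends PreSys.{u, v, w, x} L where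
  Emb : ∀ W W' : World, Set (Dom W ↪[L] Dom W')
  id_mem : ∀ W : World, Embedding.refl L (Dom W) ∈ Emb W W
  comp_mem : ∀ {W W' W'' : World} (f : Dom W ↪[L] Dom W') (g : Dom W' ↪[L] Dom W''),
    f ∈ Emb W W' → g ∈ Emb W' W'' → g.comp f ∈ Emb W W''

/-- Two tuples (in possibly different structures) satisfy the same atomic `L`-formulas. -/
def AtomicEquiv.{u, v, y, z} (L : FirstOrder.Language.{u, v}) {M : Type y} {N : Type z}
    [L.Structure M] [L.Structure N] {n : ℕ} (a : Fin n → M) (b : Fin n → N) : Prop :=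
  ∀ φ : L.Formula (Fin n), BoundedFormula.IsAtomic φ → (φ.Realize a ↔ φ.Realize b)

/-- The type of relations between pairs `(M, ā)` and `(N, b̄)` of equal parameter size. -/
abbrev BisimRel.{u, v, w, x, w', x'} {L : FirstOrder.Language.{u, v}}
    (S : PotSys.{u, v, w, x} L) (T : PotSys.{u, v, w', x'} L) :=
  ∀ (n : ℕ) (M : S.World), (Fin n → S.Dom M) → ∀ N : T.World, (Fin n → T.Dom N) → Prop

/-- `R` is a bisimulation between the potentialist systems `S` and `T`: it is nonempty, and
whenever `R` relates `(M, ā)` to `(N, b̄)`: (B1) `ā` and `b̄` satisfy the same atomic formulas;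
(B2) any extension of either tuple by one element can be matched on the other side;
(B3) any embedding on either side can be matched by an embedding on the other side. -/
def IsBisimulation.{u, v, w, x, w', x'} {L : FirstOrder.Language.{u, v}}
    (S : PotSys.{u, v, w, x} L) (T : PotSys.{u, v, w', x'} L) (R : BisimRel S T) : Prop :=
  (∃ n M a N b, R n M a N b) ∧
  ∀ (n : ℕ) (M : S.World) (a : Fin n → S.Dom M) (N : T.World) (b : Fin n → T.Dom N),
    R n M a N b →
      AtomicEquiv L a b ∧
      (∀ c : S.Dom M, ∃ d : T.Dom N, R (n + 1) M (Fin.snoc a c) N (Fin.snoc b d)) ∧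
      (∀ d : T.Dom N, ∃ c : S.Dom M, R (n + 1) M (Fin.snoc a c) N (Fin.snoc b d)) ∧
      (∀ (M' : S.World) (π : S.Dom M ↪[L] S.Dom M'), π ∈ S.Emb M M' →
        ∃ (N' : T.World) (ρ : T.Dom N ↪[L] T.Dom N'), ρ ∈ T.Emb N N' ∧
          R n M' (fun i => π (a i)) N' (fun i => ρ (b i))) ∧
      (∀ (N' : T.World) (ρ : T.Dom N ↪[L] T.Dom N'), ρ ∈ T.Emb N N' →
        ∃ (M' : S.World) (π : S.Dom M ↪[L] S.Dom M'), π ∈ S.Emb M M' ∧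
          R n M' (fun i => π (a i)) N' (fun i => ρ (b i)))

/-- Two pointed systems are bisimilar if some bisimulation relates them. -/
def Bisimilar.{u, v, w, x, w', x'} {L : FirstOrder.Language.{u, v}}
    (S : PotSys.{u, v, w, x} L) (T : PotSys.{u, v, w', x'} L)
    {n : ℕ} (M : S.World) (a : Fin n → S.Dom M) (N : T.World) (b : Fin n → T.Dom N) : Prop :=
  ∃ R : BisimRel S T, IsBisimulation S T R ∧ R n M a N b

/-- A relation is bitotal if every pair on the left is related to some pair on the right
and vice versa. -/
def Bitotal.{u, v, w, x, w', x'} {L : FirstOrder.Language.{u, v}}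
    (S : PotSys.{u, v, w, x} L) (T : PotSys.{u, v, w', x'} L) (R : BisimRel S T) : Prop :=
  (∀ (n : ℕ) (M : S.World) (a : Fin n → S.Dom M), ∃ N b, R n M a N b) ∧
  (∀ (n : ℕ) (N : T.World) (b : Fin n → T.Dom N), ∃ M a, R n M a N b)

/-- Two potentialist systems are bitotally bisimilar if there is a bitotal bisimulation
between them. -/
def BitotallyBisimilar.{u, v, w, x, w', x'} {L : FirstOrder.Language.{u, v}}
    (S : PotSys.{u, v, w, x} L) (T : PotSys.{u, v, w', x'} L) : Prop :=
  ∃ R : BisimRel S T, IsBisimulation S T R ∧ Bitotal S T R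

/-- An iso-bisimulation between potentialist systems: a nonempty relation between worlds
together with a system of isomorphisms, such that embeddings on either side can be matched
by embeddings on the other side, commuting with the isomorphisms. -/
structure IsoBisim.{u, v, w, x, w', x'} {L : FirstOrder.Language.{u, v}}
    (S : PotSys.{u, v, w, x} L) (T : PotSys.{u, v, w', x'} L) where
  rel : S.World → T.World → Prop
  nonempty : ∃ M N, rel M N
  iso : ∀ {M : S.World} {N : T.World}, rel M N → (S.Dom M ≃[L] T.Dom N)
  forth : ∀ {M : S.World} {N : T.World} (h : rel M N) (M' : S.World)
      (π : S.Dom M ↪[L] S.Dom M'), π ∈ S.Emb M M' →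
      ∃ (N' : T.World) (ρ : T.Dom N ↪[L] T.Dom N') (_ : ρ ∈ T.Emb N N') (h' : rel M' N'),
        ∀ y : S.Dom M, iso h' (π y) = ρ (iso h y)
  back : ∀ {M : S.World} {N : T.World} (h : rel M N) (N' : T.World)
      (ρ : T.Dom N ↪[L] T.Dom N'), ρ ∈ T.Emb N N' →
      ∃ (M' : S.World) (π : S.Dom M ↪[L] S.Dom M') (_ : π ∈ S.Emb M M') (h' : rel M' N'),
        ∀ y : S.Dom M, iso h' (π y) = ρ (iso h y)

/-- An iso-bisimulation is bitotal if every world on either side takes part in the relation. -/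
def IsoBisim.Bitotal.{u, v, w, x, w', x'} {L : FirstOrder.Language.{u, v}}
    {S : PotSys.{u, v, w, x} L} {T : PotSys.{u, v, w', x'} L} (I : IsoBisim S T) : Prop :=
  (∀ M : S.World, ∃ N, I.rel M N) ∧ (∀ N : T.World, ∃ M, I.rel M N)


/-- A structure `M` is `ℵ₀`-saturated if for every finite tuple `ā` of elements of `M`,
every type `p(x)` over the parameters `ā` that is finitely realized in `M` is realized
in `M`. -/
def Aleph0Saturated.{u, v, y} (L : FirstOrder.Language.{u, v}) (M : Type y)
    [L.Structure M] : Prop :=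
  ∀ (n : ℕ) (a : Fin n → M) (p : Set (L.Formula (Fin (n + 1)))),
    (∀ s : Finset (L.Formula (Fin (n + 1))), ↑s ⊆ p →
      ∃ c : M, ∀ φ ∈ s, Formula.Realize φ (Fin.snoc a c)) →
    ∃ c : M, ∀ φ ∈ p, Formula.Realize φ (Fin.snoc a c)

/-- A theory `T` is `κ`-rich, for `κ ≥ |L| + ℵ₀`, if it has an infinite model and all its
models of cardinality `κ` are `ℵ₀`-saturated. -/
def Rich.{u, v} (L : FirstOrder.Language.{u, v}) (T : L.Theory)
    (κ : Cardinal.{max u v}) : Prop :=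
  Language.card L + Cardinal.aleph0 ≤ κ ∧
  (∃ (M : Type max u v) (_ : L.Structure M), M ⊨ T ∧ Infinite M) ∧
  ∀ (M : Type max u v) (_ : L.Structure M), M ⊨ T → Cardinal.mk M = κ → Aleph0Saturated L M

/-- A theory is `κ`-categorical if any two of its models of cardinality `κ` are
isomorphic. -/
def Categorical.{u, v} (L : FirstOrder.Language.{u, v}) (T : L.Theory)
    (κ : Cardinal.{max u v}) : Prop :=
  ∀ (M N : Type max u v) (_ : L.Structure M) (_ : L.Structure N),
    M ⊨ T → N ⊨ T → Cardinal.mk M = κ → Cardinal.mk N = κ → Nonempty (M ≃[L] N)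

/-- A theory is `ℵ₀`-categorical if any two of its countably infinite models are
isomorphic. -/
def Aleph0Categorical.{u, v} (L : FirstOrder.Language.{u, v}) (T : L.Theory) : Prop :=
  ∀ (M N : Type max u v) (_ : L.Structure M) (_ : L.Structure N),
    M ⊨ T → N ⊨ T → Countable M → Infinite M → Countable N → Infinite N →
      Nonempty (M ≃[L] N)

/-- A theory `T` has quantifier elimination if every `L`-formula is `T`-equivalent to a
quantifier-free formula with the same free variables. -/
def HasQE.{u, v} (L : FirstOrder.Language.{u, v}) (T : L.Theory) : Prop :=
  ∀ (n : ℕ) (φ : L.Formula (Fin n)), ∃ ψ : L.Formula (Fin n),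
    BoundedFormula.IsQF ψ ∧
    ∀ (M : Type max u v) (_ : L.Structure M), M ⊨ T →
      ∀ a : Fin n → M, Formula.Realize φ a ↔ Formula.Realize ψ a

/-- The theory of a potentialist system: the set of (finitary, non-modal) `L`-sentences
which hold in every world. -/
def ThOf.{u, v, w, x} {L : FirstOrder.Language.{u, v}} (S : PotSys.{u, v, w, x} L) :
    L.Theory :=
  {φ : L.Sentence | ∀ W : S.World, S.Dom W ⊨ φ}


theorem sumElim_comp_snoc.{y} {K : Type y} {n : ℕ} (b : Fin n → K) (i : Unit → K) :
    Sum.elim b i ∘ (Fin.snoc Sum.inl (Sum.inr ()) : Fin (n + 1) → Fin n ⊕ Unit) =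
      Fin.snoc b (i ()) := by
  simp only [Fin.comp_snoc, Sum.elim_comp_inl, Sum.elim_inr]

/-- An elementary embedding reflects realizability, by a single element, of a finite set of formulas
over parameters from its domain. -/
theorem exists_realize_snoc_of_elementaryEmbedding.{u, v, y, z}
    {L : FirstOrder.Language.{u, v}} {M : Type y} {N : Type z} [L.Structure M] [L.Structure N]
    (f : M ↪ₑ[L] N) {n : ℕ} (a : Fin n → M) (s : Finset (L.Formula (Fin (n + 1))))
    (h : ∃ c : N, ∀ φ ∈ s, Formula.Realize φ (Fin.snoc (f ∘ a) c)) :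
    ∃ c : M, ∀ φ ∈ s, Formula.Realize φ (Fin.snoc a c) := by
  let g : Fin (n + 1) → Fin n ⊕ Unit := Fin.snoc Sum.inl (Sum.inr ())
  let ψ : L.Formula (Fin n) := Formula.iExs Unit (Formula.iInf fun φ : s => φ.1.relabel g)
  have hψ : ψ.Realize (f ∘ a) := by
    obtain ⟨c, hc⟩ := h
    refine Formula.realize_iExs.2 ⟨fun _ => c, Formula.realize_iInf.2 fun φ => ?_⟩
    rw [Formula.realize_relabel, sumElim_comp_snoc]
    exact hc φ φ.2
  obtain ⟨i, hi⟩ := Formula.realize_iExs.1 ((f.map_formula ψ a).1 hψ)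
  refine ⟨i (), fun φ hφ => ?_⟩
  rw [← sumElim_comp_snoc a, ← Formula.realize_relabel]
  exact Formula.realize_iInf.1 hi ⟨φ, hφ⟩

/-- `ℵ₀`-saturation passes to a structure every finite tuple of which lies in some
`ℵ₀`-saturated elementary substructure. -/
theorem aleph0Saturated_of_elementarySubstructures.{u, v, y}
    {L : FirstOrder.Language.{u, v}} {M : Type y} [L.Structure M]
    (h : ∀ (n : ℕ) (a : Fin n → M), ∃ S : L.ElementarySubstructure M,
      Set.range a ⊆ S ∧ Aleph0Saturated L S) :
    Aleph0Saturated L M := by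
  intro n a p hp
  obtain ⟨S, haS, hS⟩ := h n a
  let b : Fin n → S := fun i => ⟨a i, haS ⟨i, rfl⟩⟩
  have hb : S.subtype ∘ b = a := rfl
  obtain ⟨c, hc⟩ := hS n b p fun s hs =>
    exists_realize_snoc_of_elementaryEmbedding S.subtype b s (hb.symm ▸ hp s hs)
  refine ⟨S.subtype c, fun φ hφ => ?_⟩
  rw [← hb, ← Fin.comp_snoc, S.subtype.map_formula]
  exact hc φ hφ

/-- if a first-order `L`-theory `T` is `κ`-rich and `λ ≥ κ`, then `T` is
`λ`-rich. -/
theorem rich_mono.{u, v}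
    (L : FirstOrder.Language.{u, v}) (T : L.Theory) (κ μ : Cardinal.{max u v})
    (h : Rich L T κ) (hle : κ ≤ μ) : Rich L T μ := by
  obtain ⟨hκ, hinf, hsat⟩ := h
  have hω : Cardinal.aleph0 ≤ κ := le_add_self.trans hκ
  refine ⟨hκ.trans hle, hinf, fun M _ hM hcard => ?_⟩
  refine aleph0Saturated_of_elementarySubstructures fun n a => ?_
  obtain ⟨S, haS, hS⟩ := exists_elementarySubstructure_card_eq L (Set.range a) κ hω
    (Cardinal.lift_le.2 ((Set.finite_range a).lt_aleph0.le.trans hω))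
    (Cardinal.lift_le.2 (le_self_add.trans hκ))
    (Cardinal.lift_le.2 (hle.trans hcard.ge))
  exact ⟨S, haS, hsat S _ ((S.theory_model_iff T).2 hM) (Cardinal.lift_inj.1 hS)⟩

end Potentialist
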